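/- Let G be a finite non-abelian group with G = ⟨a, b⟩, where a has order at least 3 and b ≠ 1, and let m ≥ 2 be an integer. Define subsets T_{i,j} ⊆ G for i,j ∈ Z_m by: T_{i,i} = {a} for every i ∈ Z_m; T_{i,i+1} = {1} for every i ∈ Z_m with i ≠ m−1; T_{m−1,0} = {b}; and T_{i,j} = ∅ otherwise. Let Γ_m = Cay(G, T_{i,j} : i,j ∈ Z_m) be the corresponding m-Cayley digraph. Then Γ_m is oriented, regular of valency two, and its full automorphism group is exactly the group {R(h) : h ∈ G} of right translations; in particular Γ_m is an OmSR over G of valency two. -/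

import Mathlib

/-- The arc relation of the `m`-Cayley digraph `Cay(G, T_{i,j} : i,j ∈ Z_m)`:
there is an arc from `(g,i)` to `(t*g, j)` for each `t ∈ T i j`. -/
def mCayleyArc {G : Type*} [Group G] {m : ℕ} (T : ZMod m → ZMod m → Set G) :
    G × ZMod m → G × ZMod m → Prop :=
  fun x y => ∃ t ∈ T x.2 y.2, y.1 = t * x.1

/-- A permutation `σ` of the vertex set is an automorphism of the digraph with
arc relation `A` if it preserves the arc relation. -/
def IsDigraphAuto {V : Type*} (A : V → V → Prop) (σ : Equiv.Perm V) : Prop :=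
  ∀ x y : V, A (σ x) (σ y) ↔ A x y

/-- A digraph is oriented if there are no loops and no pair of oppositely
directed arcs between any two vertices. -/
def IsOrientedRel {V : Type*} (A : V → V → Prop) : Prop :=
  ∀ x y : V, A x y → ¬ A y x

/-- The right translation `R(h) : (g,i) ↦ (g*h, i)` on the vertex set `G × Z_m`. -/
def rightTransl {G : Type*} [Group G] (m : ℕ) (h : G) : Equiv.Perm (G × ZMod m) :=
  (Equiv.mulRight h).prodCongr (Equiv.refl (ZMod m))

/-- `G` admits an oriented `m`-semiregular representation (OmSR) of valency two:
there are connection sets `T i j ⊆ G` such that the corresponding `m`-Cayley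
digraph is oriented, every vertex has exactly two out-neighbours and exactly two
in-neighbours, and the full automorphism group consists exactly of the right
translations `R(h)`, `h ∈ G`. -/
def HasOmSRValencyTwo (G : Type*) [Group G] (m : ℕ) : Prop :=
  ∃ T : ZMod m → ZMod m → Set G,
    IsOrientedRel (mCayleyArc T) ∧
    (∀ x : G × ZMod m, {y | mCayleyArc T x y}.ncard = 2) ∧
    (∀ x : G × ZMod m, {y | mCayleyArc T y x}.ncard = 2) ∧
    (∀ σ : Equiv.Perm (G × ZMod m),
      IsDigraphAuto (mCayleyArc T) σ ↔ ∃ h : G, σ = rightTransl m h)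

/-- A group generated by two commuting elements is abelian. -/
theorem mul_comm_of_closure_pair_eq_top {G : Type*} [Group G] {a b : G}
    (hgen : Subgroup.closure {a, b} = ⊤) (hab : a * b = b * a) (x y : G) : x * y = y * x := by
  have hcent : ∀ g ∈ ({a, b} : Set G), ∀ z : G, g * z = z * g := by
    intro g hg z
    have hle : Subgroup.closure {a, b} ≤ Subgroup.centralizer {g} := by
      rw [Subgroup.closure_le]
      intro u hu
      rw [SetLike.mem_coe, Subgroup.mem_centralizer_singleton_iff]
      rcases hu with rfl | rfl <;> rcases hg with rfl | rfl <;> simp [hab]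
    have hz : z ∈ Subgroup.centralizer {g} := hle (hgen ▸ Subgroup.mem_top z)
    exact (Subgroup.mem_centralizer_singleton_iff.mp hz).symm
  have hle : Subgroup.closure {a, b} ≤ Subgroup.center G := by
    rw [Subgroup.closure_le]
    intro g hg
    exact Subgroup.mem_center_iff.mpr fun z => (hcent g hg z).symm
  exact (Subgroup.mem_center_iff.mp (hle (hgen ▸ Subgroup.mem_top x)) y).symm

/-- A self-map of `G = ⟨a, b⟩` commuting with left multiplication by `a` and `b` is a right
translation. -/
theorem eq_mul_map_one_of_closure_pair_eq_top {G : Type*} [Group G] {a b : G}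
    (hgen : Subgroup.closure {a, b} = ⊤) {f : G → G} (hfa : ∀ g, f (a * g) = a * f g)
    (hfb : ∀ g, f (b * g) = b * f g) (g : G) : f g = g * f 1 := by
  have key : ∀ x ∈ Subgroup.closure {a, b}, ∀ g, f (x * g) = x * f g := by
    intro x hx
    induction hx using Subgroup.closure_induction with
    | mem x hx => rcases hx with rfl | rfl <;> assumption
    | one => simp
    | mul x y _ _ hx hy => intro g; rw [mul_assoc, hx, hy, mul_assoc]
    | inv x _ hx =>
      intro g
      rw [eq_inv_mul_iff_mul_eq, ← hx, mul_inv_cancel_left]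
  simpa using key g (hgen ▸ Subgroup.mem_top g) 1

/-- Two distinct out-neighbours of `x` have a common out-neighbour. -/
def OutNeighborsMeet {V : Type*} (A : V → V → Prop) (x : V) : Prop :=
  ∃ y₁ y₂ z, y₁ ≠ y₂ ∧ A x y₁ ∧ A x y₂ ∧ A y₁ z ∧ A y₂ z

theorem IsDigraphAuto.outNeighborsMeet_iff {V : Type*} {A : V → V → Prop} {σ : Equiv.Perm V}
    (hσ : IsDigraphAuto A σ) (x : V) : OutNeighborsMeet A (σ x) ↔ OutNeighborsMeet A x := by
  constructor
  · rintro ⟨y₁, y₂, z, hne, h⟩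
    obtain ⟨y₁, rfl⟩ := σ.surjective y₁
    obtain ⟨y₂, rfl⟩ := σ.surjective y₂
    obtain ⟨z, rfl⟩ := σ.surjective z
    simp only [hσ _ _] at h
    exact ⟨y₁, y₂, z, fun e => hne (congrArg σ e), h⟩
  · rintro ⟨y₁, y₂, z, hne, h⟩
    refine ⟨σ y₁, σ y₂, σ z, σ.injective.ne hne, ?_⟩
    simpa only [hσ _ _] using h

/-- The right translations are automorphisms of every `m`-Cayley digraph. -/
theorem isDigraphAuto_rightTransl {G : Type*} [Group G] {m : ℕ} (T : ZMod m → ZMod m → Set G)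
    (h : G) : IsDigraphAuto (mCayleyArc T) (rightTransl m h) := by
  intro x y
  simp [mCayleyArc, rightTransl, ← mul_assoc]

/-- The arcs of a layered digraph: arcs within each layer labelled `a`, and arcs from layer `i` to
layer `i + 1` labelled `c i`. -/
def IsLayeredArc {G : Type*} [Group G] {m : ℕ} (A : G × ZMod m → G × ZMod m → Prop) (a : G)
    (c : ZMod m → G) : Prop :=
  ∀ x y, A x y ↔ y = (a * x.1, x.2) ∨ y = (c x.2 * x.1, x.2 + 1)

namespace IsLayeredArc

variable {G : Type*} [Group G] {m : ℕ} [Fact (1 < m)] {A : G × ZMod m → G × ZMod m → Prop}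
  {a : G} {c : ZMod m → G}

theorem ncard_out (hA : IsLayeredArc A a c) (x : G × ZMod m) : {y | A x y}.ncard = 2 := by
  have : {y | A x y} = {(a * x.1, x.2), (c x.2 * x.1, x.2 + 1)} := by
    ext y
    simp [hA x y]
  rw [this, Set.ncard_pair]
  simp

theorem ncard_in (hA : IsLayeredArc A a c) (x : G × ZMod m) : {y | A y x}.ncard = 2 := by
  have : {y | A y x} = {(a⁻¹ * x.1, x.2), ((c (x.2 - 1))⁻¹ * x.1, x.2 - 1)} := by
    ext ⟨g, i⟩
    obtain ⟨h, j⟩ := x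
    simp only [Set.mem_ofPred_eq, hA _ _, Set.mem_insert_iff, Set.mem_singleton_iff,
      Prod.mk.injEq, eq_inv_mul_iff_mul_eq]
    constructor
    · rintro (⟨rfl, rfl⟩ | ⟨rfl, rfl⟩) <;> simp
    · rintro (⟨rfl, rfl⟩ | ⟨rfl, rfl⟩) <;> simp
  rw [this, Set.ncard_pair]
  intro h
  simpa [eq_sub_iff_add_eq] using congrArg Prod.snd h

/-- If an automorphism preserves layer `i`, it preserves layer `i + 1`. -/
theorem layer_succ (hA : IsLayeredArc A a c) {σ : Equiv.Perm (G × ZMod m)}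
    (hσ : IsDigraphAuto A σ) {i : ZMod m} (hi : ∀ g, (σ (g, i)).2 = i) (g : G) :
    (σ (g, i + 1)).2 = i + 1 := by
  have h₁ : A (σ ((c i)⁻¹ * g, i)) (σ (g, i + 1)) := by
    rw [hσ _ _, hA _ _]; simp
  have h₂ : A (σ ((c i)⁻¹ * g, i)) (σ (a * ((c i)⁻¹ * g), i)) := by
    rw [hσ _ _, hA _ _]; simp
  rw [hA _ _, hi] at h₁ h₂
  have h₃ : σ (a * ((c i)⁻¹ * g), i) = (a * (σ ((c i)⁻¹ * g, i)).1, i) := by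
    refine h₂.resolve_right fun h => ?_
    have := congrArg Prod.snd h
    simp [hi] at this
  rcases h₁ with h | h
  · have := congrArg Prod.snd (σ.injective (h.trans h₃.symm))
    simp at this
  · rw [h]

/-- An automorphism preserving one layer preserves all of them. -/
theorem layer_eq (hA : IsLayeredArc A a c) {σ : Equiv.Perm (G × ZMod m)}
    (hσ : IsDigraphAuto A σ) {i : ZMod m} (hi : ∀ g, (σ (g, i)).2 = i) (g : G) (j : ZMod m) :
    (σ (g, j)).2 = j := by
  have key : ∀ (n : ℕ) (g : G), (σ (g, i + n)).2 = i + n := by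
    intro n
    induction n with
    | zero => simpa using hi
    | succ n ih => simpa [add_assoc] using hA.layer_succ hσ ih
  have : NeZero m := ⟨(zero_lt_one.trans (Fact.out : 1 < m)).ne'⟩
  obtain ⟨n, hn⟩ := ZMod.natCast_zmod_surjective (j - i)
  simpa [hn] using key n g

/-- On a layer-preserving automorphism, both kinds of arcs are preserved. -/
theorem map_fst (hA : IsLayeredArc A a c) {σ : Equiv.Perm (G × ZMod m)}
    (hσ : IsDigraphAuto A σ) (hl : ∀ g j, (σ (g, j)).2 = j) (g : G) (i : ZMod m) :
    (σ (a * g, i)).1 = a * (σ (g, i)).1 ∧ (σ (c i * g, i + 1)).1 = c i * (σ (g, i)).1 := by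
  have h₁ : A (σ (g, i)) (σ (a * g, i)) := by rw [hσ _ _, hA _ _]; simp
  have h₂ : A (σ (g, i)) (σ (c i * g, i + 1)) := by rw [hσ _ _, hA _ _]; simp
  rw [hA _ _, Prod.ext_iff, Prod.ext_iff] at h₁ h₂
  simp only [hl] at h₁ h₂
  simpa using And.intro h₁ h₂

variable {b : G}

theorem isOrientedRel (hA : IsLayeredArc A a fun i => if i = -1 then b else 1)
    (ha : 3 ≤ orderOf a) (hb : b ≠ 1) : IsOrientedRel A := by
  rintro ⟨g, i⟩ ⟨h, j⟩ h₁ h₂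
  simp only [hA _ _, Prod.mk.injEq] at h₁ h₂
  rcases h₁ with ⟨rfl, rfl⟩ | ⟨rfl, rfl⟩
  · rcases h₂ with ⟨h, -⟩ | ⟨-, h⟩
    · have h' : a ^ 2 = 1 := by
        rw [← mul_assoc, right_eq_mul] at h
        rw [pow_two, h]
      have := Nat.le_of_dvd two_pos (orderOf_dvd_of_pow_eq_one h')
      omega
    · simp at h
  · rcases h₂ with ⟨-, h⟩ | ⟨h, h'⟩
    · simp at h
    · have h2 : (1 : ZMod m) + 1 = 0 := by
        rwa [add_assoc, left_eq_add] at h'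
      have hm : m = 2 := by
        have hd : m ∣ 2 := (ZMod.natCast_eq_zero_iff 2 m).mp (by rw [← h2]; norm_num)
        have := Nat.le_of_dvd two_pos hd
        have := (Fact.out : 1 < m)
        omega
      subst hm
      rw [← mul_assoc, right_eq_mul] at h
      have hi : i = 0 ∨ i = 1 := (by decide : ∀ k : ZMod 2, k = 0 ∨ k = 1) i
      have h01 : (0 : ZMod 2) ≠ -1 := by decide
      have h11 : (1 : ZMod 2) = -1 := by decide
      have h110 : (1 : ZMod 2) + 1 = 0 := by decide
      rcases hi with rfl | rfl
      · rw [zero_add, if_neg h01, if_pos h11, mul_one] at h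
        exact hb h
      · rw [h110, if_neg h01, if_pos h11, one_mul] at h
        exact hb h

theorem outNeighborsMeet_iff (hA : IsLayeredArc A a fun i => if i = -1 then b else 1)
    (hab : a * b ≠ b * a) (x : G × ZMod m) : OutNeighborsMeet A x ↔ x.2 ≠ -1 := by
  obtain ⟨g, i⟩ := x
  constructor
  · rintro ⟨y₁, y₂, z, hne, h₁, h₂, hz₁, hz₂⟩ (rfl : i = -1)
    have h0 : (0 : ZMod m) ≠ -1 := by simp
    have key : A (a * g, -1) z → ¬ A (b * g, 0) z := by
      intro hz₁ hz₂
      rw [hA _ _] at hz₁ hz₂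
      rcases hz₁ with rfl | rfl <;> simp [← mul_assoc] at hz₂
      · exact hab (by rw [← hz₂.1, mul_assoc])
      · exact hab hz₂.symm
    rw [hA _ _] at h₁ h₂
    simp only [if_true, neg_add_cancel] at h₁ h₂
    rcases h₁ with rfl | rfl <;> rcases h₂ with rfl | rfl
    · exact hne rfl
    · exact key hz₁ hz₂
    · exact key hz₂ hz₁
    · exact hne rfl
  · intro (hi : i ≠ -1)
    refine ⟨(a * g, i), (g, i + 1), (a * g, i + 1), ?_, ?_, ?_, ?_, ?_⟩ <;> simp [hA _ _, hi]

theorem isDigraphAuto_imp_rightTransl (hA : IsLayeredArc A a fun i => if i = -1 then b else 1)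
    (hgen : Subgroup.closure {a, b} = ⊤) (hab : a * b ≠ b * a) {σ : Equiv.Perm (G × ZMod m)}
    (hσ : IsDigraphAuto A σ) : ∃ h : G, σ = rightTransl m h := by
  have hlast : ∀ g, (σ (g, -1)).2 = -1 := by
    intro g
    have := hσ.outNeighborsMeet_iff (g, -1)
    rw [hA.outNeighborsMeet_iff hab, hA.outNeighborsMeet_iff hab] at this
    exact not_not.mp (by simpa using this)
  have hl := hA.layer_eq hσ hlast
  have hmap := hA.map_fst hσ hl
  have hconst : ∀ (n : ℕ) (g : G), n < m → (σ (g, (n : ZMod m))).1 = (σ (g, 0)).1 := by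
    intro n g hn
    induction n with
    | zero => simp
    | succ n ih =>
      have hne : (n : ZMod m) ≠ -1 := by
        intro h
        have hd : m ∣ n + 1 := by
          rw [← ZMod.natCast_eq_zero_iff]
          simp [h]
        exact absurd (Nat.le_of_dvd n.succ_pos hd) (by omega)
      have := (hmap g n).2
      simp only [if_neg hne, one_mul] at this
      rw [Nat.cast_succ, this, ih (by omega)]
  have : NeZero m := ⟨(zero_lt_one.trans (Fact.out : 1 < m)).ne'⟩
  have hfst : ∀ g j, (σ (g, j)).1 = (σ (g, 0)).1 := by
    intro g j
    simpa using hconst j.val g j.val_lt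
  have hfb : ∀ g, (σ (b * g, 0)).1 = b * (σ (g, 0)).1 := by
    intro g
    have := (hmap g (-1)).2
    simp only [if_true, neg_add_cancel] at this
    rw [this, hfst]
  refine ⟨(σ (1, 0)).1, Equiv.ext fun ⟨g, j⟩ => Prod.ext ?_ (hl g j)⟩
  rw [hfst, eq_mul_map_one_of_closure_pair_eq_top (f := fun g => (σ (g, 0)).1) hgen
    (fun g => (hmap g 0).1) hfb g]
  rfl

end IsLayeredArc

/-- The explicit construction of Case 2 of Lemma 3.2 for a non-abelian group
`G = ⟨a,b⟩` with `o(a) ≥ 3`, `b ≠ 1` and `m ≥ 2`: with `T_{i,i} = {a}` for all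
`i`, `T_{i,i+1} = {1}` for `i ≠ m-1`, `T_{m-1,0} = {b}` and `T_{i,j} = ∅`
otherwise, the `m`-Cayley digraph `Γ_m = Cay(G, T_{i,j})` is an OmSR over `G`
of valency two. -/
theorem nonabelian_explicit_omsr
    (G : Type*) [Group G] [Fintype G] (hna : ∃ x y : G, x * y ≠ y * x)
    (a b : G) (hgen : Subgroup.closure {a, b} = ⊤)
    (ha : 3 ≤ orderOf a) (hb : b ≠ 1)
    (m : ℕ) (hm : 2 ≤ m)
    (T : ZMod m → ZMod m → Set G)
    (hT : ∀ i j : ZMod m, T i j =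
      {t | (j = i ∧ t = a) ∨
           (i ≠ ((m - 1 : ℕ) : ZMod m) ∧ j = i + 1 ∧ t = 1) ∨
           (i = ((m - 1 : ℕ) : ZMod m) ∧ j = 0 ∧ t = b)}) :
    IsOrientedRel (mCayleyArc T) ∧
    (∀ x : G × ZMod m, {y | mCayleyArc T x y}.ncard = 2) ∧
    (∀ x : G × ZMod m, {y | mCayleyArc T y x}.ncard = 2) ∧
    (∀ σ : Equiv.Perm (G × ZMod m),
      IsDigraphAuto (mCayleyArc T) σ ↔ ∃ h : G, σ = rightTransl m h) := by
  have : Fact (1 < m) := ⟨hm⟩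
  have hlast : ((m - 1 : ℕ) : ZMod m) = -1 := by
    rw [Nat.cast_sub (by omega)]
    simp
  have hA : IsLayeredArc (mCayleyArc T) a fun i => if i = -1 then b else 1 := by
    rintro ⟨g, i⟩ ⟨h, j⟩
    by_cases hi : i = -1
    · subst hi
      simp [mCayleyArc, hT, hlast]
      grind
    · simp [mCayleyArc, hT, hlast, hi]
      grind [one_mul]
  have hab : a * b ≠ b * a := fun h =>
    let ⟨x, y, hxy⟩ := hna
    hxy (mul_comm_of_closure_pair_eq_top hgen h x y)
  refine ⟨hA.isOrientedRel ha hb, hA.ncard_out, hA.ncard_in, fun σ =>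
    ⟨hA.isDigraphAuto_imp_rightTransl hgen hab, ?_⟩⟩
  rintro ⟨h, rfl⟩
  exact isDigraphAuto_rightTransl T h
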